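/- arXiv:2408.05222 — 2 statements merged into one kernel-verified Lean document; each statement's English description precedes it below -/
import Mathlib

section
/- Let n ≥ 1, let h be a gauge function, and let R be a roof function supported in [0,1]^n. For each positive integer m there exist a function f_m ∈ F_n(R,h) and a finite collection {d_{m,k}}_k of dyadic cubes belonging to ∪_{j=0}^{m-1} D_j, with pairwise disjoint interiors, such that: (1) 3^n ∫_{d_{m,k}} f_m dV_n = h(V_n(d_{m,k})) for every k; (2) Σ_k h(V_n(d_{m,k})) ≤ h(1); and (3) 3^n ∫_{[0,1]^n} f_m dV_n = ∫_{[0,1]^n \ ∪_k d_{m,k}} min{R, 2^{nm} h(2^{-nm})} dV_n + Σ_k h(V_n(d_{m,k})). -/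
open MeasureTheory Set Filter Topology

/-- A gauge function: continuous, increasing on `[0,∞)`, vanishing at `0`, with
`(R1)` `h x / x` decreasing and `(R2)` `h x / x → ∞` as `x → 0+`. -/
structure IsGauge (h : ℝ → ℝ) : Prop where
  continuousOn : ContinuousOn h (Set.Ici 0)
  mono : MonotoneOn h (Set.Ici 0)
  zero : h 0 = 0
  r1 : ∀ ⦃x y : ℝ⦄, 0 < x → x ≤ y → h y / y ≤ h x / x
  r2 : Filter.Tendsto (fun x => h x / x) (nhdsWithin 0 (Set.Ioi 0)) Filter.atTop

/-- A cube in `ℝ^n`: a product of closed intervals of a common positive length. -/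
def IsCube {n : ℕ} (c : Set (Fin n → ℝ)) : Prop :=
  ∃ (a : Fin n → ℝ) (s : ℝ), 0 < s ∧ c = Set.univ.pi fun i => Set.Icc (a i) (a i + s)

/-- The closed unit cube `[0,1]^n`. -/
def unitCube (n : ℕ) : Set (Fin n → ℝ) := Set.univ.pi fun _ => Set.Icc (0 : ℝ) 1

/-- `M_h(R)`: the infimum over all countable families of cubes `{c k}` (degenerate
empty members allowed, so that finite families are included) of
`Σ_k h(V_n(c_k)) + ∫_{ℝ^n \ ∪_k c_k} R dV_n`. -/
noncomputable def Mh {n : ℕ} (h : ℝ → ℝ) (R : (Fin n → ℝ) → ENNReal) : ENNReal :=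
  ⨅ (c : ℕ → Set (Fin n → ℝ)) (_ : ∀ k, IsCube (c k) ∨ c k = ∅),
    (∑' k, ENNReal.ofReal (h (volume (c k)).toReal)) + ∫⁻ x in (⋃ k, c k)ᶜ, R x

/-- Membership in the class `F_n(R,h)`: `f : ℝ^n → [0,∞)` measurable with
`∫_c f ≤ h(V_n(c))` for every cube `c` and `f ≤ R` a.e. -/
structure MemF {n : ℕ} (h : ℝ → ℝ) (R : (Fin n → ℝ) → ENNReal)
    (f : (Fin n → ℝ) → NNReal) : Prop where
  measurable : Measurable f
  cube_bound : ∀ c : Set (Fin n → ℝ), IsCube c →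
    ∫⁻ x in c, (f x : ENNReal) ≤ ENNReal.ofReal (h (volume c).toReal)
  le_roof : ∀ᵐ x ∂volume, (f x : ENNReal) ≤ R x

/-- A dyadic cube of generation `j` in `[0,1]^n`: side length `2^{-j}`, with corner
at a point of the lattice `2^{-j}·ℕ^n` inside the unit cube. -/
def IsDyadicCube {n : ℕ} (j : ℕ) (d : Set (Fin n → ℝ)) : Prop :=
  ∃ k : Fin n → ℕ, (∀ i, k i < 2 ^ j) ∧
    d = Set.univ.pi fun i => Set.Icc ((k i : ℝ) / 2 ^ j) (((k i : ℝ) + 1) / 2 ^ j)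

/-- The index of the half-open dyadic cell of side length `2^{-j}` containing `x`. -/
noncomputable def dyadicIndex {n : ℕ} (j : ℕ) (x : Fin n → ℝ) : Fin n → ℤ :=
  fun i => ⌊x i * 2 ^ j⌋

/-- The half-open dyadic cell of side length `2^{-j}` with index `k`. -/
def dyadicCell {n : ℕ} (j : ℕ) (k : Fin n → ℤ) : Set (Fin n → ℝ) :=
  {x | dyadicIndex j x = k}

/-- The value of the gauge `h` at the volume of a dyadic cube of generation `j`,
as an extended nonnegative real. -/
noncomputable def dyadicGauge (n : ℕ) (h : ℝ → ℝ) (j : ℕ) : ENNReal :=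
  ENNReal.ofReal (h (((2 : ℝ) ^ (n * j))⁻¹))

section Cells

variable {n : ℕ}

lemma measurable_dyadicIndex (j : ℕ) :
    Measurable (dyadicIndex j : (Fin n → ℝ) → Fin n → ℤ) := by
  unfold dyadicIndex
  fun_prop

lemma measurableSet_dyadicCell (j : ℕ) (k : Fin n → ℤ) : MeasurableSet (dyadicCell j k) :=
  measurable_dyadicIndex j (measurableSet_singleton k)

lemma floor_mul_two_pow_eq_of_le {i j : ℕ} (hij : j ≤ i) {a b : ℝ}
    (hab : ⌊a * 2 ^ i⌋ = ⌊b * 2 ^ i⌋) : ⌊a * 2 ^ j⌋ = ⌊b * 2 ^ j⌋ := by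
  obtain ⟨t, rfl⟩ := Nat.exists_eq_add_of_le hij
  have key (c : ℝ) : ⌊c * 2 ^ j⌋ = ⌊c * 2 ^ (j + t)⌋ / (2 ^ t : ℕ) := by
    rw [← Int.floor_div_natCast]
    congr 1
    push_cast
    rw [pow_add]
    field_simp
  rw [key a, key b, hab]

lemma dyadicIndex_eq_of_le {i j : ℕ} (hij : j ≤ i) {x y : Fin n → ℝ}
    (hxy : dyadicIndex i x = dyadicIndex i y) : dyadicIndex j x = dyadicIndex j y :=
  funext fun l => floor_mul_two_pow_eq_of_le hij (congrFun hxy l)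

lemma dyadicCell_eq_pi_Ico (j : ℕ) (k : Fin n → ℤ) :
    dyadicCell j k =
      Set.univ.pi fun i => Set.Ico ((k i : ℝ) / 2 ^ j) (((k i : ℝ) + 1) / 2 ^ j) := by
  ext x
  have h2 : (0 : ℝ) < 2 ^ j := by positivity
  simp only [dyadicCell, dyadicIndex, Set.mem_ofPred_eq, funext_iff, Int.floor_eq_iff,
    Set.mem_univ_pi, Set.mem_Ico, div_le_iff₀ h2, lt_div_iff₀ h2]

lemma dyadicCell_ae_eq_closed (j : ℕ) (k : Fin n → ℤ) :
    dyadicCell j k =ᵐ[volume]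
      Set.univ.pi fun i => Set.Icc ((k i : ℝ) / 2 ^ j) (((k i : ℝ) + 1) / 2 ^ j) := by
  rw [dyadicCell_eq_pi_Ico, Set.pi_univ_Icc]
  exact Measure.univ_pi_Ico_ae_eq_Icc

lemma interior_closed_subset_dyadicCell (j : ℕ) (k : Fin n → ℤ) :
    interior (Set.univ.pi fun i => Set.Icc ((k i : ℝ) / 2 ^ j) (((k i : ℝ) + 1) / 2 ^ j))
      ⊆ dyadicCell j k := by
  rw [dyadicCell_eq_pi_Ico, interior_pi_set Set.finite_univ]
  simp only [interior_Icc]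
  exact Set.pi_mono fun i _ => Set.Ioo_subset_Ico_self

lemma volume_univ_pi_Icc_add (a : Fin n → ℝ) {s : ℝ} (hs : 0 ≤ s) :
    volume (Set.univ.pi fun i => Set.Icc (a i) (a i + s)) = ENNReal.ofReal (s ^ n) := by
  rw [volume_pi_pi]
  simp [ENNReal.ofReal_pow hs]

lemma volume_closed_dyadic (j : ℕ) (k : Fin n → ℤ) :
    volume (Set.univ.pi fun i => Set.Icc ((k i : ℝ) / 2 ^ j) (((k i : ℝ) + 1) / 2 ^ j))
      = ENNReal.ofReal (((2 : ℝ) ^ (n * j))⁻¹) := by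
  have := volume_univ_pi_Icc_add (fun i => (k i : ℝ) / 2 ^ j) (s := ((2 : ℝ) ^ j)⁻¹)
    (by positivity)
  rw [inv_pow, ← pow_mul, mul_comm j n] at this
  simp_rw [← this, add_div, one_div]

lemma volume_dyadicCell (j : ℕ) (k : Fin n → ℤ) :
    volume (dyadicCell j k) = ENNReal.ofReal (((2 : ℝ) ^ (n * j))⁻¹) := by
  rw [measure_congr (dyadicCell_ae_eq_closed j k), volume_closed_dyadic]

lemma dyadicCell_zero_ae_eq_unitCube :
    dyadicCell 0 (0 : Fin n → ℤ) =ᵐ[volume] unitCube n := by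
  simpa [unitCube] using dyadicCell_ae_eq_closed 0 (0 : Fin n → ℤ)

lemma dyadicIndex_mem_Ico {j : ℕ} {x : Fin n → ℝ} (hx : x ∈ dyadicCell 0 (0 : Fin n → ℤ))
    (i : Fin n) : dyadicIndex j x i ∈ Finset.Ico (0 : ℤ) (2 ^ j) := by
  have h2 : (0 : ℝ) < 2 ^ j := by positivity
  rw [dyadicCell_eq_pi_Ico] at hx
  have := hx i (Set.mem_univ i)
  simp only [Pi.zero_apply, Int.cast_zero, pow_zero, div_one, zero_add, Set.mem_Ico] at this
  rw [Finset.mem_Ico, dyadicIndex, Int.floor_nonneg, Int.floor_lt]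
  refine ⟨by nlinarith, ?_⟩
  push_cast
  nlinarith

lemma univ_pi_Icc_subset_iUnion_dyadicCell (a : Fin n → ℝ) {s : ℝ} (p : ℕ)
    (hs : s * 2 ^ p ≤ 2) :
    (Set.univ.pi fun i => Set.Icc (a i) (a i + s)) ⊆
      ⋃ e : Fin n → Fin 3, dyadicCell p fun i => dyadicIndex p a i + ((e i : ℕ) : ℤ) := by
  intro x hx
  have h2 : (0 : ℝ) < 2 ^ p := by positivity
  have hl (i : Fin n) : ⌊a i * 2 ^ p⌋ ≤ ⌊x i * 2 ^ p⌋ :=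
    Int.floor_mono (mul_le_mul_of_nonneg_right (hx i (Set.mem_univ i)).1 h2.le)
  have hu (i : Fin n) : ⌊x i * 2 ^ p⌋ ≤ ⌊a i * 2 ^ p⌋ + 2 := by
    rw [← Int.floor_add_ofNat]
    apply Int.floor_mono
    nlinarith [(hx i (Set.mem_univ i)).2]
  refine Set.mem_iUnion.2 ⟨fun i => ⟨(⌊x i * 2 ^ p⌋ - ⌊a i * 2 ^ p⌋).toNat, ?_⟩, ?_⟩
  · have := hl i
    have := hu i
    omega
  · funext i
    have := hl i
    simp only [dyadicIndex]
    omega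

lemma setLIntegral_eq_inter_dyadicCell_zero {g : (Fin n → ℝ) → ENNReal}
    (hg : ∀ x, x ∉ unitCube n → g x = 0) (A : Set (Fin n → ℝ)) :
    ∫⁻ x in A, g x = ∫⁻ x in A ∩ dyadicCell 0 0, g x := by
  rw [← lintegral_inter_add_sdiff g A (measurableSet_dyadicCell 0 (0 : Fin n → ℤ))]
  have hae : ∀ᵐ x ∂volume, x ∈ (dyadicCell 0 (0 : Fin n → ℤ))ᶜ → g x = 0 := by
    filter_upwards [dyadicCell_zero_ae_eq_unitCube.mem_iff] with x hx hxc
    exact hg x fun hU => hxc (hx.2 hU)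
  have hz : ∫⁻ x in (dyadicCell 0 (0 : Fin n → ℤ))ᶜ, g x = 0 := by
    rw [setLIntegral_congr_fun_ae (measurableSet_dyadicCell 0 _).compl hae]
    simp
  have hdiff : ∫⁻ x in A \ dyadicCell 0 (0 : Fin n → ℤ), g x = 0 :=
    le_antisymm ((lintegral_mono_set fun x hx => hx.2).trans hz.le) zero_le
  rw [hdiff, add_zero]

lemma setLIntegral_eq_inter_unitCube {g : (Fin n → ℝ) → ENNReal}
    (hg : ∀ x, x ∉ unitCube n → g x = 0) (A : Set (Fin n → ℝ)) :
    ∫⁻ x in A, g x = ∫⁻ x in unitCube n ∩ A, g x := by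
  rw [setLIntegral_eq_inter_dyadicCell_zero hg, Set.inter_comm]
  exact setLIntegral_congr (dyadicCell_zero_ae_eq_unitCube.inter (ae_eq_refl A))

lemma mem_piFinset_of_setLIntegral_ne_zero {g : (Fin n → ℝ) → ENNReal}
    (hg : ∀ x, x ∉ unitCube n → g x = 0) {j : ℕ} {k : Fin n → ℤ}
    (hk : ∫⁻ x in dyadicCell j k, g x ≠ 0) :
    k ∈ Fintype.piFinset fun _ => Finset.Ico (0 : ℤ) (2 ^ j) := by
  rw [setLIntegral_eq_inter_dyadicCell_zero hg] at hk
  obtain he | ⟨x, rfl, hx⟩ := (dyadicCell j k ∩ dyadicCell 0 0).eq_empty_or_nonempty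
  · simp [he] at hk
  · exact Fintype.mem_piFinset.2 (dyadicIndex_mem_Ico hx)

end Cells

/-- The function `g` and the finite family `S` of cells solve the dyadic truncation problem
for `g₀` down to generation `j`: `g` satisfies the gauge bound on cells of generations
`j, …, m`, attains it on the pairwise disjoint cells of `S`, and equals `g₀` off them. -/
structure IsDyadicTruncation {n : ℕ} (h : ℝ → ℝ) (g₀ : (Fin n → ℝ) → ENNReal) (m j : ℕ)
    (g : (Fin n → ℝ) → ENNReal) (S : Finset (ℕ × (Fin n → ℤ))) : Prop where
  measurable : Measurable g
  le : ∀ x, g x ≤ g₀ x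
  le_gen : ∀ p ∈ S, j ≤ p.1
  gen_lt : ∀ p ∈ S, p.1 < m
  index_mem : ∀ p ∈ S, p.2 ∈ Fintype.piFinset fun _ => Finset.Ico (0 : ℤ) (2 ^ p.1)
  integral_eq : ∀ p ∈ S, ∫⁻ x in dyadicCell p.1 p.2, g x = dyadicGauge n h p.1
  disjoint : ∀ p ∈ S, ∀ q ∈ S, p ≠ q → Disjoint (dyadicCell p.1 p.2) (dyadicCell q.1 q.2)
  eq_off : ∀ x, (∀ p ∈ S, x ∉ dyadicCell p.1 p.2) → g x = g₀ x
  integral_le : ∀ i, j ≤ i → i ≤ m → ∀ k,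
    ∫⁻ x in dyadicCell i k, g x ≤ dyadicGauge n h i

section Truncation

variable {n : ℕ} {h : ℝ → ℝ} {g₀ : (Fin n → ℝ) → ENNReal} {m : ℕ}

/-- One step of the truncation: rescale `g` on every cell of generation `j` violating
the gauge bound. -/
lemma IsDyadicTruncation.descend {j : ℕ} {g : (Fin n → ℝ) → ENNReal}
    {S : Finset (ℕ × (Fin n → ℤ))} (hT : IsDyadicTruncation h g₀ m (j + 1) g S) (hjm : j < m)
    (hsupp : ∀ x, x ∉ unitCube n → g₀ x = 0) {C : ENNReal} (hC : C ≠ ⊤)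
    (hg₀C : ∀ x, g₀ x ≤ C) :
    ∃ g' S', IsDyadicTruncation h g₀ m j g' S' := by
  classical
  have hgsupp : ∀ x, x ∉ unitCube n → g x = 0 := fun x hx =>
    le_antisymm ((hT.le x).trans (hsupp x hx).le) zero_le
  set I : (Fin n → ℤ) → ENNReal := fun k => ∫⁻ x in dyadicCell j k, g x with hI
  have hIfin (k) : I k ≠ ⊤ := by
    refine ne_top_of_le_ne_top ?_ (lintegral_mono fun x => (hT.le x).trans (hg₀C x))
    rw [setLIntegral_const, volume_dyadicCell]
    exact ENNReal.mul_ne_top hC ENNReal.ofReal_ne_top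
  set F : (Fin n → ℤ) → ENNReal :=
    fun k => if dyadicGauge n h j < I k then dyadicGauge n h j / I k else 1 with hF
  have hF1 (k) : F k ≤ 1 := by
    simp only [hF]
    split_ifs with hk
    · exact ENNReal.div_le_of_le_mul (by simpa using hk.le)
    · exact le_rfl
  have hFI {k} (hk : dyadicGauge n h j < I k) : F k * I k = dyadicGauge n h j := by
    simp only [hF, if_pos hk]
    exact ENNReal.div_mul_cancel (zero_le.trans_lt hk).ne' (hIfin k)
  have hFone {k} (hk : ¬ dyadicGauge n h j < I k) : F k = 1 := if_neg hk
  set B : Finset (Fin n → ℤ) :=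
    {k ∈ Fintype.piFinset fun _ => Finset.Ico (0 : ℤ) (2 ^ j) | dyadicGauge n h j < I k} with hB
  have hBmem (k) : k ∈ B ↔ dyadicGauge n h j < I k := by
    rw [hB, Finset.mem_filter, and_iff_right_iff_imp]
    exact fun hk => mem_piFinset_of_setLIntegral_ne_zero hgsupp (zero_le.trans_lt hk).ne'
  set g' : (Fin n → ℝ) → ENNReal := fun x => F (dyadicIndex j x) * g x with hg'
  have hg'le (x) : g' x ≤ g x := mul_le_of_le_one_left zero_le (hF1 _)
  have hint {i : ℕ} (hij : j ≤ i) (y : Fin n → ℝ) :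
      ∫⁻ x in dyadicCell i (dyadicIndex i y), g' x
        = F (dyadicIndex j y) * ∫⁻ x in dyadicCell i (dyadicIndex i y), g x := by
    rw [← lintegral_const_mul _ hT.measurable]
    refine setLIntegral_congr_fun (measurableSet_dyadicCell _ _) fun x hx => ?_
    simp only [hg', dyadicIndex_eq_of_le hij hx]
  set S' : Finset (ℕ × (Fin n → ℤ)) :=
    B.image (fun k => (j, k)) ∪
      {p ∈ S | ∀ k ∈ B, Disjoint (dyadicCell p.1 p.2) (dyadicCell j k)} with hS'
  have hS'mem (p) : p ∈ S' ↔ (p.1 = j ∧ p.2 ∈ B) ∨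
      (p ∈ S ∧ ∀ k ∈ B, Disjoint (dyadicCell p.1 p.2) (dyadicCell j k)) := by
    rw [hS', Finset.mem_union, Finset.mem_filter, Finset.mem_image]
    refine or_congr_left ⟨?_, ?_⟩
    · rintro ⟨k, hk, rfl⟩
      exact ⟨rfl, hk⟩
    · rintro ⟨rfl, hk⟩
      exact ⟨p.2, hk, rfl⟩
  have hmono (i : ℕ) (k) : ∫⁻ x in dyadicCell i k, g' x ≤ ∫⁻ x in dyadicCell i k, g x :=
    lintegral_mono hg'le
  refine ⟨g', S', ?_, fun x => (hg'le x).trans (hT.le x), ?_, ?_, ?_, ?_, ?_, ?_, ?_⟩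
  · exact ((measurable_of_countable F).comp (measurable_dyadicIndex j)).mul hT.measurable
  · intro p hp
    obtain ⟨h1, -⟩ | ⟨h1, -⟩ := (hS'mem p).1 hp
    · exact h1.ge
    · exact (Nat.le_succ j).trans (hT.le_gen p h1)
  · intro p hp
    obtain ⟨h1, -⟩ | ⟨h1, -⟩ := (hS'mem p).1 hp
    · exact h1 ▸ hjm
    · exact hT.gen_lt p h1
  · intro p hp
    obtain ⟨h1, h2⟩ | ⟨h1, -⟩ := (hS'mem p).1 hp
    · rw [h1]
      exact (Finset.mem_filter.1 h2).1
    · exact hT.index_mem p h1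
  · rintro ⟨i, k⟩ hp
    obtain ⟨h1, h2⟩ | ⟨h1, h2⟩ := (hS'mem _).1 hp
    · obtain rfl : i = j := h1
      have hk := (hBmem k).1 h2
      obtain he | ⟨y, rfl⟩ := (dyadicCell i k).eq_empty_or_nonempty
      · simp [hI, he] at hk
      · exact (hint le_rfl y).trans (hFI hk)
    · rw [← hT.integral_eq _ h1]
      refine setLIntegral_congr_fun (measurableSet_dyadicCell _ _) fun x hx => ?_
      have hx' : ¬ dyadicGauge n h j < I (dyadicIndex j x) := fun hlt =>
        Set.disjoint_left.1 (h2 _ ((hBmem _).2 hlt)) hx rfl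
      simp only [hg', hFone hx', one_mul]
  · intro p hp q hq hpq
    obtain ⟨hp1, hp2⟩ | ⟨hp1, hp2⟩ := (hS'mem p).1 hp <;>
      obtain ⟨hq1, hq2⟩ | ⟨hq1, hq2⟩ := (hS'mem q).1 hq
    · refine Set.disjoint_left.2 fun x hx hx' => hpq (Prod.ext (hp1.trans hq1.symm) ?_)
      rw [hp1] at hx
      rw [hq1] at hx'
      exact hx.symm.trans hx'
    · rw [hp1]
      exact (hq2 _ hp2).symm
    · rw [hq1]
      exact hp2 _ hq2
    · exact hT.disjoint p hp1 q hq1 hpq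
  · intro x hx
    have hxB : dyadicIndex j x ∉ B := fun hk =>
      hx (j, dyadicIndex j x) ((hS'mem _).2 (Or.inl ⟨rfl, hk⟩)) rfl
    have hgx : g' x = g x := by
      simp only [hg', hFone (fun hk => hxB ((hBmem _).2 hk)), one_mul]
    rw [hgx]
    refine hT.eq_off x fun p hp hxp => hx p ((hS'mem p).2 (Or.inr ⟨hp, fun k hk => ?_⟩)) hxp
    refine Set.disjoint_left.2 fun z hz hzk => hxB ?_
    have hzx : dyadicIndex p.1 x = dyadicIndex p.1 z :=
      (show dyadicIndex p.1 x = p.2 from hxp).trans (Eq.symm hz)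
    rw [dyadicIndex_eq_of_le ((Nat.le_succ j).trans (hT.le_gen p hp)) hzx]
    exact (show dyadicIndex j z = k from hzk) ▸ hk
  · intro i hij him k
    obtain hlt | rfl := hij.lt_or_eq
    · exact (hmono i k).trans (hT.integral_le i hlt him k)
    · by_cases hk : dyadicGauge n h j < I k
      · obtain he | ⟨y, rfl⟩ := (dyadicCell j k).eq_empty_or_nonempty
        · simp [he]
        · exact ((hint le_rfl y).trans (hFI hk)).le
      · exact (hmono j k).trans (not_lt.1 hk)

lemma exists_isDyadicTruncation (hmeas : Measurable g₀)
    (hsupp : ∀ x, x ∉ unitCube n → g₀ x = 0)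
    (hg₀C : ∀ x, g₀ x ≤ ENNReal.ofReal ((2 : ℝ) ^ (n * m) * h (((2 : ℝ) ^ (n * m))⁻¹))) :
    ∃ g S, IsDyadicTruncation h g₀ m 0 g S := by
  have hmain : ∀ j ≤ m, ∃ g S, IsDyadicTruncation h g₀ m j g S := by
    intro j hj
    induction hj using Nat.decreasingInduction with
    | self =>
      refine ⟨g₀, ∅, hmeas, fun x => le_rfl, by simp, by simp, by simp, by simp, by simp,
        fun _ _ => rfl, fun i h1 h2 k => ?_⟩
      obtain rfl := le_antisymm h1 h2
      refine (lintegral_mono hg₀C).trans ?_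
      rw [setLIntegral_const, volume_dyadicCell, mul_comm, ← ENNReal.ofReal_mul (by positivity),
        inv_mul_cancel_left₀ (by positivity)]
      rfl
    | of_succ j hj ih =>
      obtain ⟨g, S, hT⟩ := ih
      exact hT.descend hj hsupp ENNReal.ofReal_ne_top hg₀C
  exact hmain 0 (Nat.zero_le m)

/-- A dyadic gauge bound together with a bound on the density at the finest scale implies the
gauge bound on all cubes, up to the factor `3 ^ n`. -/
lemma setLIntegral_le_of_dyadic (hg : IsGauge h) {g : (Fin n → ℝ) → ENNReal}
    (hsupp : ∀ x, x ∉ unitCube n → g x = 0)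
    (hgC : ∀ x, g x ≤ ENNReal.ofReal ((2 : ℝ) ^ (n * m) * h (((2 : ℝ) ^ (n * m))⁻¹)))
    (hdy : ∀ i ≤ m, ∀ k, ∫⁻ x in dyadicCell i k, g x ≤ dyadicGauge n h i)
    {c : Set (Fin n → ℝ)} (hc : IsCube c) :
    ∫⁻ x in c, g x ≤ 3 ^ n * ENNReal.ofReal (h (volume c).toReal) := by
  obtain ⟨a, s, hs, rfl⟩ := hc
  have hsn : 0 < s ^ n := by positivity
  have h3 (b : ENNReal) : b ≤ 3 ^ n * b :=
    le_mul_of_one_le_left zero_le (one_le_pow₀ (by norm_num))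
  rw [volume_univ_pi_Icc_add a hs.le, ENNReal.toReal_ofReal hsn.le]
  obtain hs1 | hs1 := le_or_gt 1 s
  · rw [setLIntegral_eq_inter_dyadicCell_zero hsupp]
    refine (lintegral_mono_set Set.inter_subset_right).trans <|
      (hdy 0 (Nat.zero_le m) 0).trans <| le_trans ?_ (h3 _)
    refine ENNReal.ofReal_le_ofReal (hg.mono (by simp) hsn.le ?_)
    simpa using one_le_pow₀ hs1
  obtain ⟨q, hq1, hq2⟩ := exists_nat_pow_near_of_lt_one hs hs1.le
    (by norm_num : (0 : ℝ) < 1 / 2) (by norm_num)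
  obtain hqm | hqm := lt_or_ge q m
  · have hcov := univ_pi_Icc_subset_iUnion_dyadicCell a (s := s) (q + 1) (by
      calc s * 2 ^ (q + 1) ≤ (1 / 2) ^ q * 2 ^ (q + 1) := by gcongr
        _ = 2 := by rw [one_div, inv_pow, pow_succ, inv_mul_cancel_left₀ (by positivity)])
    calc _ ≤ _ := lintegral_mono_set hcov
      _ ≤ ∑' e : Fin n → Fin 3,
          ∫⁻ x in dyadicCell (q + 1) fun i => dyadicIndex (q + 1) a i + ((e i : ℕ) : ℤ), g x :=
        lintegral_iUnion_le _ _
      _ ≤ ∑' _ : Fin n → Fin 3, dyadicGauge n h (q + 1) :=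
        ENNReal.tsum_le_tsum fun e => hdy _ hqm _
      _ = 3 ^ n * dyadicGauge n h (q + 1) := by simp [tsum_fintype]
      _ ≤ 3 ^ n * ENNReal.ofReal (h (s ^ n)) := by
        refine mul_le_mul_right (ENNReal.ofReal_le_ofReal (hg.mono ?_ hsn.le ?_)) _
        · exact Set.mem_Ici.2 (by positivity)
        · rw [mul_comm, pow_mul, ← inv_pow, ← inv_pow, ← one_div]
          gcongr
  · refine le_trans ?_ (h3 _)
    refine (lintegral_mono hgC).trans ?_
    have hle : s ^ n ≤ ((2 : ℝ) ^ (n * m))⁻¹ := by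
      rw [mul_comm, pow_mul, ← inv_pow, ← inv_pow, ← one_div]
      gcongr
      exact hq2.trans (pow_le_pow_of_le_one (by norm_num) (by norm_num) hqm)
    rw [setLIntegral_const, volume_univ_pi_Icc_add a hs.le, mul_comm,
      ← ENNReal.ofReal_mul hsn.le]
    refine ENNReal.ofReal_le_ofReal ?_
    have := hg.r1 hsn hle
    rw [div_inv_eq_mul, le_div_iff₀ hsn] at this
    linarith

end Truncation

/-- the almost-solution lemma. For each `m ≥ 1` there exist
`f_m ∈ F_n(R,h)` and a finite collection of dyadic cubes of generations `< m`
with pairwise disjoint interiors satisfying properties (1), (2), (3). -/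
theorem almost_solution {n : ℕ} (hn : 1 ≤ n) (h : ℝ → ℝ) (hg : IsGauge h)
    (R : (Fin n → ℝ) → ENNReal) (hRmeas : Measurable R)
    (hRsupp : ∀ x, x ∉ unitCube n → R x = 0)
    (m : ℕ) (hm : 0 < m) :
    ∃ (f : (Fin n → ℝ) → NNReal) (K : ℕ) (d : Fin K → Set (Fin n → ℝ)),
      MemF h R f ∧
      (∀ k, ∃ j < m, IsDyadicCube j (d k)) ∧
      (∀ k l, k ≠ l → Disjoint (interior (d k)) (interior (d l))) ∧
      (∀ k, (3 : ENNReal) ^ n * ∫⁻ x in d k, (f x : ENNReal)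
          = ENNReal.ofReal (h (volume (d k)).toReal)) ∧
      (∑ k, ENNReal.ofReal (h (volume (d k)).toReal) ≤ ENNReal.ofReal (h 1)) ∧
      ((3 : ENNReal) ^ n * ∫⁻ x in unitCube n, (f x : ENNReal)
          = (∫⁻ x in unitCube n \ ⋃ k, d k,
              min (R x) (ENNReal.ofReal ((2 : ℝ) ^ (n * m) * h (((2 : ℝ) ^ (n * m))⁻¹))))
            + ∑ k, ENNReal.ofReal (h (volume (d k)).toReal)) := by
  set C : ENNReal := ENNReal.ofReal ((2 : ℝ) ^ (n * m) * h (((2 : ℝ) ^ (n * m))⁻¹))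
  set g₀ : (Fin n → ℝ) → ENNReal := fun x => min (R x) C with hg₀
  have hg₀supp : ∀ x, x ∉ unitCube n → g₀ x = 0 := fun x hx => by simp [hg₀, hRsupp x hx]
  have hg₀C : ∀ x, g₀ x ≤ C := fun x => min_le_right _ _
  obtain ⟨g, S, hT⟩ := exists_isDyadicTruncation (h := h) (m := m)
    (hRmeas.min measurable_const) hg₀supp hg₀C
  have hgsupp : ∀ x, x ∉ unitCube n → g x = 0 := fun x hx =>
    le_antisymm ((hT.le x).trans (hg₀supp x hx).le) zero_le
  have hgC : ∀ x, g x ≤ C := fun x => (hT.le x).trans (hg₀C x)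
  have h3 : (3 : ENNReal) ^ n ≠ 0 := by positivity
  have h3' : (3 : ENNReal) ^ n ≠ ⊤ := ENNReal.pow_ne_top (by norm_num)
  set f : (Fin n → ℝ) → NNReal := fun x => (((3 : ENNReal) ^ n)⁻¹ * g x).toNNReal
  have hfg (x) : (f x : ENNReal) = ((3 : ENNReal) ^ n)⁻¹ * g x :=
    ENNReal.coe_toNNReal (ENNReal.mul_ne_top (ENNReal.inv_ne_top.2 h3)
      (ne_top_of_le_ne_top ENNReal.ofReal_ne_top (hgC x)))
  have hfint (A : Set (Fin n → ℝ)) :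
      ∫⁻ x in A, (f x : ENNReal) = ((3 : ENNReal) ^ n)⁻¹ * ∫⁻ x in A, g x := by
    simp_rw [hfg]
    exact lintegral_const_mul _ hT.measurable
  have hfint3 (A : Set (Fin n → ℝ)) :
      (3 : ENNReal) ^ n * ∫⁻ x in A, (f x : ENNReal) = ∫⁻ x in A, g x := by
    rw [hfint, ENNReal.mul_inv_cancel_left h3 h3']
  set D : ℕ × (Fin n → ℤ) → Set (Fin n → ℝ) := fun p =>
    Set.univ.pi fun i => Set.Icc ((p.2 i : ℝ) / 2 ^ p.1) (((p.2 i : ℝ) + 1) / 2 ^ p.1) with hD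
  have hDcell (p) : dyadicCell p.1 p.2 =ᵐ[volume] D p := dyadicCell_ae_eq_closed p.1 p.2
  have hDvol (p) : ENNReal.ofReal (h (volume (D p)).toReal) = dyadicGauge n h p.1 := by
    rw [hD, volume_closed_dyadic, ENNReal.toReal_ofReal (by positivity)]
    rfl
  set d : Fin S.card → Set (Fin n → ℝ) := fun k => D (S.equivFin.symm k) with hd
  have hdsum : ∑ k, ENNReal.ofReal (h (volume (d k)).toReal)
      = ∫⁻ x in ⋃ p ∈ S, dyadicCell p.1 p.2, g x := by
    rw [lintegral_biUnion_finset (fun p hp q hq hpq => hT.disjoint p hp q hq hpq)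
      (fun p _ => measurableSet_dyadicCell p.1 p.2)]
    simp_rw [hd, hDvol]
    rw [Equiv.sum_comp S.equivFin.symm (fun p : S => dyadicGauge n h p.1.1),
      Finset.sum_coe_sort S (fun p => dyadicGauge n h p.1)]
    exact Finset.sum_congr rfl fun p hp => (hT.integral_eq p hp).symm
  have hdUnion : (⋃ p ∈ S, dyadicCell p.1 p.2) =ᵐ[volume] ⋃ k, d k := by
    have hU : (⋃ k, d k) = ⋃ p ∈ S, D p :=
      (S.equivFin.symm.surjective.iUnion_comp fun p : S => D p).trans
        (Set.iUnion_subtype _ fun p : S => D p)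
    rw [hU]
    exact Finset.eventuallyEq_iUnion S fun p _ => hDcell p
  refine ⟨f, S.card, d, ⟨?_, fun c hc => ?_, ?_⟩, fun k => ?_, fun k l hkl => ?_, fun k => ?_,
    ?_, ?_⟩
  · exact (hT.measurable.const_mul _).ennreal_toNNReal
  · rw [hfint, mul_comm, ← div_eq_mul_inv]
    exact ENNReal.div_le_of_le_mul' (setLIntegral_le_of_dyadic hg hgsupp hgC
      (fun i hi k => hT.integral_le i (Nat.zero_le i) hi k) hc)
  · refine Filter.Eventually.of_forall fun x => ?_
    rw [hfg]
    refine (mul_le_of_le_one_left zero_le ?_).trans ((hT.le x).trans (min_le_left _ _))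
    exact ENNReal.inv_le_one.2 (one_le_pow₀ (by norm_num))
  · have hp := (S.equivFin.symm k).2
    have hmem (i) := Finset.mem_Ico.1 (Fintype.mem_piFinset.1 (hT.index_mem _ hp) i)
    refine ⟨_, hT.gen_lt _ hp, fun i => ((S.equivFin.symm k).1.2 i).toNat, fun i => ?_, ?_⟩
    · rw [Int.toNat_lt (hmem i).1]
      exact_mod_cast (hmem i).2
    · have hcast (i) : ((((S.equivFin.symm k).1.2 i).toNat : ℕ) : ℝ)
          = ((S.equivFin.symm k).1.2 i : ℝ) := by
        exact_mod_cast Int.toNat_of_nonneg (hmem i).1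
      simp_rw [hcast]
      rfl
  · refine (hT.disjoint _ (S.equivFin.symm k).2 _ (S.equivFin.symm l).2 fun he =>
      hkl (S.equivFin.symm.injective (Subtype.ext he))).mono ?_ ?_ <;>
    exact interior_closed_subset_dyadicCell _ _
  · rw [hfint3, hd, hDvol, ← setLIntegral_congr (hDcell _)]
    exact hT.integral_eq _ (S.equivFin.symm k).2
  · rw [hdsum, setLIntegral_eq_inter_dyadicCell_zero hgsupp]
    refine (lintegral_mono_set Set.inter_subset_right).trans
      ((hT.integral_le 0 le_rfl (Nat.zero_le m) 0).trans ?_)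
    simp [dyadicGauge]
  · have hWmeas : MeasurableSet (⋃ p ∈ S, dyadicCell p.1 p.2) :=
      S.measurableSet_biUnion fun p _ => measurableSet_dyadicCell p.1 p.2
    rw [hfint3, hdsum, setLIntegral_eq_inter_unitCube hgsupp (⋃ p ∈ S, dyadicCell p.1 p.2),
      ← lintegral_inter_add_sdiff g (unitCube n) hWmeas, add_comm]
    congr 1
    rw [← setLIntegral_congr ((ae_eq_refl (unitCube n)).diff hdUnion)]
    have hUmeas : MeasurableSet (unitCube n) := MeasurableSet.univ_pi fun _ => measurableSet_Icc
    refine setLIntegral_congr_fun (hUmeas.diff hWmeas) fun x hx => hT.eq_off x fun p hp hxp =>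
      hx.2 (Set.mem_biUnion hp hxp)
end

section
/- Let h be a gauge function and let w be a non-negative function in L^1(|dζ|) on 𝕋 such that ∫_E log w |dζ| = -∞ for every h-Carleson set E ⊂ 𝕋 of positive arclength measure. Fix N > 0 and an arc I ⊂ 𝕋, let A_N = {ζ ∈ 𝕋 : log^+(1/w(ζ)) ≤ N}, and let R_{N,I} be the function equal to log^+(1/w) on I \ A_N and 0 elsewhere on 𝕋. Then for every countable family {I_k}_k of arcs of 𝕋 one has Σ_k h(|I_k|) + ∫_{𝕋 \ ∪_k I_k} R_{N,I} |dζ| ≥ h(|I|). -/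
open MeasureTheory Set Filter Topology

noncomputable section

local instance : Fact (0 < 2 * Real.pi) := ⟨by positivity⟩

/-- The unit circle `𝕋`, modelled as `ℝ / 2πℤ` with its arclength (Haar) measure,
of total mass `2π`. -/
abbrev UnitCircle := AddCircle (2 * Real.pi)

/-- An arc of the circle: a connected subset (the empty set is allowed as a
degenerate arc). -/
def IsArc (I : Set UnitCircle) : Prop := IsPreconnected I

/-- An `h`-Carleson set: a closed subset of the circle whose complement is a countable
disjoint union of open arcs `I_k` (namely its maximal complementary arcs) with
`Σ_k h(|I_k|) < ∞`. -/
def IsHCarleson (h : ℝ → ℝ) (E : Set UnitCircle) : Prop :=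
  IsClosed E ∧ ∃ I : ℕ → Set UnitCircle,
    (∀ k, IsOpen (I k) ∧ IsPreconnected (I k)) ∧
    (∀ k l, k ≠ l → Disjoint (I k) (I l)) ∧
    (⋃ k, I k) = Eᶜ ∧
    (∑' k, ENNReal.ofReal (h (volume (I k)).toReal)) < ⊤

/-- `nlog t = log⁺(1/t)`, valued in `[0,∞]`, with `nlog 0 = ∞`. For `w ≥ 0` this is
the function `R = log⁺(1/w)` of Khrushchev; moreover, since the positive part of
`log w` is automatically integrable for `w ∈ L¹`, the divergence condition
`∫_E log w |dζ| = -∞` is faithfully expressed as `∫⁻_E nlog (w ζ) |dζ| = ∞`. -/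
def nlog (t : ℝ) : ENNReal := if t = 0 then ⊤ else ENNReal.ofReal (Real.log t⁻¹)

/-- A connected subset of the circle is, up to its endpoints, the image of an interval. -/
theorem IsArc.exists_Ioo_subset_subset_Icc {J : Set UnitCircle} (hJ : IsArc J) :
    ∃ c d : ℝ, c ≤ d ∧
      ((↑) : ℝ → UnitCircle) '' Ioo c d ⊆ J ∧ J ⊆ ((↑) : ℝ → UnitCircle) '' Icc c d := by
  rcases J.eq_empty_or_nonempty with rfl | hne
  · exact ⟨0, 0, le_rfl, by simp, by simp⟩
  by_cases huniv : J = univ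
  · subst huniv
    exact ⟨0, 0 + 2 * Real.pi, by linarith [Real.pi_pos], subset_univ _,
      (AddCircle.coe_image_Icc_eq (2 * Real.pi) 0).ge⟩
  obtain ⟨a', ha'⟩ := (ne_univ_iff_exists_notMem J).1 huniv
  obtain ⟨a, rfl⟩ := QuotientAddGroup.mk_surjective a'
  let e := AddCircle.openPartialHomeomorphCoe (2 * Real.pi) a
  have hJt : J ⊆ e.target := fun x hx hxa => ha' (by
    have : x = (a : UnitCircle) := hxa
    rw [this] at hx
    exact hx)
  set S : Set ℝ := e.symm '' J with hS
  have hSsub : S ⊆ Ioo a (a + 2 * Real.pi) := by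
    rintro _ ⟨x, hx, rfl⟩
    exact e.map_target (hJt hx)
  have hSJ : ((↑) : ℝ → UnitCircle) '' S = J := by
    rw [hS, image_image]
    refine (image_congr fun x hx => ?_).trans (image_id J)
    exact e.right_inv (hJt hx)
  have hSpre : IsPreconnected S := hJ.image _ (e.continuousOn_symm.mono hJt)
  have hSne : S.Nonempty := hne.image _
  have hbb : BddBelow S := ⟨a, fun x hx => (hSsub hx).1.le⟩
  have hba : BddAbove S := ⟨a + 2 * Real.pi, fun x hx => (hSsub hx).2.le⟩
  refine ⟨sInf S, sSup S, csInf_le_csSup hSne hbb hba, ?_, ?_⟩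
  · rw [← hSJ]
    exact image_mono (IsConnected.Ioo_csInf_csSup_subset ⟨hSne, hSpre⟩ hbb hba)
  · conv_lhs => rw [← hSJ]
    exact image_mono (subset_Icc_csInf_csSup hbb hba)

theorem isOpen_coe_image_Ioo (c d : ℝ) : IsOpen (((↑) : ℝ → UnitCircle) '' Ioo c d) :=
  QuotientAddGroup.isOpenMap_coe _ isOpen_Ioo

theorem isPreconnected_coe_image_Ioo (c d : ℝ) :
    IsPreconnected (((↑) : ℝ → UnitCircle) '' Ioo c d) :=
  isPreconnected_Ioo.image _ (AddCircle.continuous_mk' _).continuousOn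

instance UnitCircle.nullSingletonClass : NullSingletonClass (volume : Measure UnitCircle) where
  measure_singleton x := by
    rw [← Metric.closedBall_zero, AddCircle.volume_closedBall]
    simp [Real.pi_pos.le]

instance UnitCircle.locallyConnectedSpace : LocallyConnectedSpace UnitCircle :=
  (QuotientAddGroup.isQuotientMap_mk (N := AddSubgroup.zmultiples (2 * Real.pi))
    ).isCoinducing.locallyConnectedSpace

theorem volume_coe_image_Icc_diff_Ioo (c d : ℝ) :
    volume (((↑) : ℝ → UnitCircle) '' Icc c d \ ((↑) : ℝ → UnitCircle) '' Ioo c d) = 0 := by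
  refine (Set.Finite.subset (s := {(c : UnitCircle), (d : UnitCircle)}) (by simp) ?_).measure_zero _
  rintro _ ⟨⟨x, hx, rfl⟩, hx'⟩
  rcases hx.1.eq_or_lt with rfl | h1
  · simp
  rcases hx.2.eq_or_lt with rfl | h2
  · simp
  exact absurd ⟨x, ⟨h1, h2⟩, rfl⟩ hx'

theorem compl_coe_image_Icc {c d : ℝ} (hcd : c ≤ d) :
    (((↑) : ℝ → UnitCircle) '' Icc c d)ᶜ =
      ((↑) : ℝ → UnitCircle) '' Ioo d (c + 2 * Real.pi) := by
  apply Subset.antisymm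
  · intro z hz
    have : z ∈ ((↑) : ℝ → UnitCircle) '' Ico c (c + 2 * Real.pi) := by
      rw [AddCircle.coe_image_Ico_eq]; trivial
    obtain ⟨x, hx, rfl⟩ := this
    refine ⟨x, ⟨?_, hx.2⟩, rfl⟩
    by_contra! hxd
    exact hz ⟨x, ⟨hx.1, hxd⟩, rfl⟩
  · rintro _ ⟨x, hx, rfl⟩ ⟨y, hy, hyx⟩
    have hxI : x ∈ Ico c (c + 2 * Real.pi) := ⟨hcd.trans hx.1.le, hx.2⟩
    have hyI : y ∈ Ico c (c + 2 * Real.pi) := ⟨hy.1, hy.2.trans_lt (hx.1.trans hx.2)⟩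
    have := (AddCircle.coe_eq_coe_iff_of_mem_Ico hyI hxI).1 hyx
    linarith [hy.2, hx.1]

theorem IsGauge.nonneg {h : ℝ → ℝ} (hg : IsGauge h) {x : ℝ} (hx : 0 ≤ x) : 0 ≤ h x := by
  simpa [hg.zero] using hg.mono (by simp : (0 : ℝ) ∈ Ici 0) hx hx

theorem IsGauge.ofReal_mono {h : ℝ → ℝ} (hg : IsGauge h) {s t : ENNReal} (ht : t ≠ ⊤)
    (hst : s ≤ t) : ENNReal.ofReal (h s.toReal) ≤ ENNReal.ofReal (h t.toReal) :=
  ENNReal.ofReal_le_ofReal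
    (hg.mono ENNReal.toReal_nonneg ENNReal.toReal_nonneg (ENNReal.toReal_mono ht hst))

/-- Gauge functions are countably subadditive. -/
theorem IsGauge.ofReal_le_tsum {h : ℝ → ℝ} (hg : IsGauge h) {a : ENNReal} {t : ℕ → ENNReal}
    (ha : a ≠ ⊤) (ht : ∀ k, t k ≠ ⊤) (hat : a ≤ ∑' k, t k) :
    ENNReal.ofReal (h a.toReal) ≤ ∑' k, ENNReal.ofReal (h (t k).toReal) := by
  by_cases hex : ∃ k, a ≤ t k
  · obtain ⟨k, hk⟩ := hex
    exact (hg.ofReal_mono (ht k) hk).trans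
      (ENNReal.le_tsum (f := fun k => ENNReal.ofReal (h (t k).toReal)) k)
  push Not at hex
  have ha0 : 0 < a := zero_le.trans_lt (hex 0)
  have hapos : 0 < a.toReal := ENNReal.toReal_pos ha0.ne' ha
  have hslope : 0 ≤ h a.toReal / a.toReal := div_nonneg (hg.nonneg hapos.le) hapos.le
  calc ENNReal.ofReal (h a.toReal)
      = ENNReal.ofReal (h a.toReal / a.toReal) * a := by
        conv_rhs => rw [← ENNReal.ofReal_toReal ha]
        rw [← ENNReal.ofReal_mul (by simpa [ENNReal.ofReal_toReal ha] using hslope)]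
        rw [ENNReal.ofReal_toReal ha, div_mul_cancel₀ _ hapos.ne']
    _ ≤ ENNReal.ofReal (h a.toReal / a.toReal) * ∑' k, t k := by gcongr
    _ = ∑' k, ENNReal.ofReal (h a.toReal / a.toReal) * t k := ENNReal.tsum_mul_left.symm
    _ ≤ ∑' k, ENNReal.ofReal (h (t k).toReal) := by
        refine ENNReal.tsum_le_tsum fun k => ?_
        rcases eq_or_ne (t k) 0 with h0 | h0
        · simp [h0]
        have hpos : 0 < (t k).toReal := ENNReal.toReal_pos h0 (ht k)
        have hle := hg.r1 hpos (ENNReal.toReal_mono ha (hex k).le)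
        nth_rewrite 1 [← ENNReal.ofReal_toReal (ht k)]
        rw [← ENNReal.ofReal_mul hslope]
        exact ENNReal.ofReal_le_ofReal ((le_div_iff₀ hpos).1 hle)

/-- The complement of a union of open arcs, disjoint or not, with finite total gauge is an
`h`-Carleson set. -/
theorem IsGauge.isHCarleson_compl_iUnion {h : ℝ → ℝ} (hg : IsGauge h) {O : ℕ → Set UnitCircle}
    (hO : ∀ k, IsOpen (O k)) (hOc : ∀ k, IsPreconnected (O k))
    (hsum : ∑' k, ENNReal.ofReal (h (volume (O k)).toReal) ≠ ⊤) :
    IsHCarleson h (⋃ k, O k)ᶜ := by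
  classical
  set U := ⋃ k, O k with hU
  have hUo : IsOpen U := isOpen_iUnion hO
  refine ⟨hUo.isClosed_compl, ?_⟩
  have hexC : ∀ k, ∃ C : Set UnitCircle, IsOpen C ∧ IsPreconnected C ∧ C ⊆ U ∧ O k ⊆ C ∧
      ∀ x ∈ C, C = connectedComponentIn U x := by
    intro k
    rcases (O k).eq_empty_or_nonempty with h0 | ⟨x, hx⟩
    · exact ⟨∅, isOpen_empty, isPreconnected_empty, empty_subset _, h0.le, by simp⟩
    · exact ⟨connectedComponentIn U x, hUo.connectedComponentIn,
        isPreconnected_connectedComponentIn, connectedComponentIn_subset _ _,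
        (hOc k).subset_connectedComponentIn hx (subset_iUnion O k),
        fun y hy => connectedComponentIn_eq hy⟩
  choose C hCo hCc hCU hOC hCeq using hexC
  have hex : ∀ j, ∃ m, C m = C j := fun j => ⟨j, rfl⟩
  let m : ℕ → ℕ := fun j => Nat.find (hex j)
  have hm : ∀ j, C (m j) = C j := fun j => Nat.find_spec (hex j)
  have hm_congr : ∀ i j, C i = C j → m i = m j := fun i j hij => by
    simp only [m, hij]
  refine ⟨fun k => if m k = k then C k else ∅, fun k => ?_, fun k l hkl => ?_, ?_, ?_⟩
  · dsimp only
    split_ifs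
    · exact ⟨hCo k, hCc k⟩
    · exact ⟨isOpen_empty, isPreconnected_empty⟩
  · dsimp only
    split_ifs with hk hl <;> try simp
    rw [Set.disjoint_left]
    intro x hxk hxl
    exact hkl (by rw [← hk, ← hl, hm_congr k l ((hCeq k x hxk).trans (hCeq l x hxl).symm)])
  · rw [compl_compl]
    apply Subset.antisymm
    · refine iUnion_subset fun k => ?_
      split_ifs
      · exact hCU k
      · exact empty_subset _
    · intro x hx
      obtain ⟨j, hj⟩ := mem_iUnion.1 hx
      refine mem_iUnion.2 ⟨m j, ?_⟩
      rw [if_pos (hm_congr _ _ (hm j)), hm j]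
      exact hOC j hj
  · refine lt_of_le_of_lt ?_ hsum.lt_top
    calc ∑' k, ENNReal.ofReal (h (volume (if m k = k then C k else ∅)).toReal)
        ≤ ∑' k, ∑' j, ENNReal.ofReal (h (volume (if k = m j then O j else ∅)).toReal) := by
          refine ENNReal.tsum_le_tsum fun k => ?_
          refine hg.ofReal_le_tsum (measure_ne_top _ _) (fun _ => measure_ne_top _ _) ?_
          refine (measure_mono ?_).trans (measure_iUnion_le _)
          split_ifs with hk
          · intro x hx
            obtain ⟨j, hj⟩ := mem_iUnion.1 (hCU k hx)
            refine mem_iUnion.2 ⟨j, ?_⟩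
            rw [if_pos]
            · exact hj
            · rw [← hk]
              exact hm_congr _ _ ((hCeq k x hx).trans (hCeq j x (hOC j hj)).symm)
          · exact empty_subset _
      _ = ∑' j, ∑' k, ENNReal.ofReal (h (volume (if k = m j then O j else ∅)).toReal) :=
          ENNReal.tsum_comm
      _ = ∑' j, ENNReal.ofReal (h (volume (O j)).toReal) := by
          refine tsum_congr fun j => ?_
          rw [tsum_eq_single (m j) fun k hk => by simp [hk, hg.zero]]
          simp

/-- With `R_{N,I}` equal to `log⁺(1/w)` on `I \ A_N` and `0`
elsewhere, any countable family of arcs `{I_k}` satisfies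
`Σ_k h(|I_k|) + ∫_{𝕋 \ ∪ I_k} R_{N,I} ≥ h(|I|)`. -/
theorem semicover_lower_bound (h : ℝ → ℝ) (hg : IsGauge h)
    (w : UnitCircle → ℝ) (hw0 : ∀ ζ, 0 ≤ w ζ) (hw1 : Integrable w volume)
    (hdiv : ∀ E : Set UnitCircle, IsHCarleson h E → 0 < volume E →
      ∫⁻ ζ in E, nlog (w ζ) = ⊤)
    (N : ℕ) (hN : 0 < N) (I : Set UnitCircle) (hI : IsArc I) :
    ∀ J : ℕ → Set UnitCircle, (∀ k, IsArc (J k)) →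
      ENNReal.ofReal (h (volume I).toReal) ≤
        (∑' k, ENNReal.ofReal (h (volume (J k)).toReal)) +
          ∫⁻ ζ in (⋃ k, J k)ᶜ,
            (I \ {ζ' | nlog (w ζ') ≤ (N : ENNReal)}).indicator
              (fun ζ' => nlog (w ζ')) ζ := by
  intro J hJ
  set R : UnitCircle → ENNReal :=
    (I \ {ζ' | nlog (w ζ') ≤ (N : ENNReal)}).indicator (fun ζ' => nlog (w ζ')) with hR
  rcases eq_or_ne (∑' k, ENNReal.ofReal (h (volume (J k)).toReal)) ⊤ with hs | hs
  · simp [hs]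
  rcases eq_or_ne (∫⁻ ζ in (⋃ k, J k)ᶜ, R ζ) ⊤ with hi | hi
  · rw [hi]
    simp
  choose c d _ hsub hsup using fun k => (hJ k).exists_Ioo_subset_subset_Icc
  obtain ⟨a, b, hab, hIsub, hIsup⟩ := hI.exists_Ioo_subset_subset_Icc
  set O : ℕ → Set UnitCircle := fun k => ((↑) : ℝ → UnitCircle) '' Ioo (c k) (d k) with hO
  set P : Set UnitCircle := ((↑) : ℝ → UnitCircle) '' Ioo b (a + 2 * Real.pi) with hP
  have hPc : (((↑) : ℝ → UnitCircle) '' Icc a b)ᶜ = P := compl_coe_image_Icc hab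
  have hOle : ∑' k, ENNReal.ofReal (h (volume (O k)).toReal) ≤
      ∑' k, ENNReal.ofReal (h (volume (J k)).toReal) :=
    ENNReal.tsum_le_tsum fun k => hg.ofReal_mono (measure_ne_top _ _) (measure_mono (hsub k))
  let Q : ℕ → Set UnitCircle := fun k => Nat.casesOn k P O
  have hQU : ⋃ k, Q k = P ∪ ⋃ k, O k := by
    ext x
    simp only [mem_iUnion, mem_union]
    exact ⟨fun ⟨k, hk⟩ => by cases k with
      | zero => exact Or.inl hk
      | succ k => exact Or.inr ⟨k, hk⟩,
      fun hx => hx.elim (fun hx => ⟨0, hx⟩) fun ⟨k, hk⟩ => ⟨k + 1, hk⟩⟩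
  set E : Set UnitCircle := (⋃ k, Q k)ᶜ with hE
  have hEC : IsHCarleson h E := by
    refine hg.isHCarleson_compl_iUnion (fun k => ?_) (fun k => ?_) ?_
    · cases k <;> exact isOpen_coe_image_Ioo _ _
    · cases k <;> exact isPreconnected_coe_image_Ioo _ _
    · rw [tsum_eq_zero_add' ENNReal.summable]
      exact ENNReal.add_ne_top.2 ⟨ENNReal.ofReal_ne_top, ne_top_of_le_ne_top hs hOle⟩
  have hEI : volume (E \ I) = 0 := by
    refine measure_mono_null ?_ (volume_coe_image_Icc_diff_Ioo a b)
    rintro x ⟨hxE, hxI⟩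
    refine ⟨by_contra fun hx => hxE ?_, fun hx => hxI (hIsub hx)⟩
    rw [hQU]
    exact Or.inl (hPc ▸ hx)
  have hEJ : volume (E \ (⋃ k, J k)ᶜ) = 0 := by
    refine measure_mono_null ?_
      (measure_iUnion_null fun k => volume_coe_image_Icc_diff_Ioo (c k) (d k))
    rintro x ⟨hxE, hxJ⟩
    obtain ⟨k, hk⟩ := mem_iUnion.1 (not_not.1 hxJ)
    refine mem_iUnion.2 ⟨k, hsup k hk, fun hx => hxE ?_⟩
    rw [hQU]
    exact Or.inr (mem_iUnion.2 ⟨k, hx⟩)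
  have hE0 : volume E = 0 := by
    by_contra hne
    refine absurd (hdiv E hEC (pos_iff_ne_zero.2 hne)) (ne_of_lt ?_)
    calc ∫⁻ ζ in E, nlog (w ζ) ≤ ∫⁻ ζ in E, ((N : ENNReal) + R ζ) := by
          refine lintegral_mono_ae ?_
          rw [ae_restrict_iff' hEC.1.measurableSet]
          filter_upwards [measure_eq_zero_iff_ae_notMem.1 hEI] with ζ hζ hζE
          have hζI : ζ ∈ I := by_contra fun hn => hζ ⟨hζE, hn⟩
          by_cases hle : nlog (w ζ) ≤ (N : ENNReal)
          · exact hle.trans le_self_add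
          · rw [hR, indicator_of_mem (show ζ ∈ I \ {ζ' | nlog (w ζ') ≤ (N : ENNReal)} from
              ⟨hζI, hle⟩)]
            exact le_add_self
      _ = (N : ENNReal) * volume E + ∫⁻ ζ in E, R ζ := by
          rw [lintegral_add_left measurable_const, setLIntegral_const]
      _ ≤ (N : ENNReal) * volume E + ∫⁻ ζ in (⋃ k, J k)ᶜ, R ζ := by
          gcongr 1
          exact lintegral_mono_set' (ae_le_set.2 hEJ)
      _ < ⊤ := ENNReal.add_lt_top.2
          ⟨ENNReal.mul_lt_top (ENNReal.natCast_lt_top N) (measure_lt_top _ _), hi.lt_top⟩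
  have hIle : volume I ≤ ∑' k, volume (O k) := by
    calc volume I ≤ volume (E ∪ ⋃ k, O k) := by
          refine measure_mono fun x hx => ?_
          by_cases hxE : x ∈ E
          · exact Or.inl hxE
          · rw [hE, notMem_compl_iff, hQU] at hxE
            refine Or.inr (hxE.resolve_left fun hxP => ?_)
            rw [← hPc] at hxP
            exact hxP (hIsup hx)
      _ ≤ volume E + volume (⋃ k, O k) := measure_union_le _ _
      _ ≤ ∑' k, volume (O k) := by
          rw [hE0, zero_add]
          exact measure_iUnion_le _
  exact ((hg.ofReal_le_tsum (measure_ne_top _ _) (fun _ => measure_ne_top _ _) hIle).trans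
    hOle).trans le_self_add
end
end
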